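/- Alt_8[ [ρ_{4,3}] ⊗ [ρ_{3,2}] ⊗ [ρ_{2,1}] ⊗ [ρ_1] ] = −14 · Alt_8[ [⟨1234⟩] ⊗ [⟨2345⟩] ⊗ [⟨3456⟩] ⊗ [⟨4567⟩] ] in V_F^{⊗4}, where [ρ_{i,j}] denotes the class of ρ_i − ρ_j in V_F. -/

import Mathlib

open scoped TensorProduct
open PiTensorProduct

attribute [local instance] Classical.propDecidable

set_option maxHeartbeats 1000000
set_option synthInstance.maxHeartbeats 400000

noncomputable section

namespace GrassPoly

variable (F : Type) [Field F]

/-- `V_F = F^× ⊗_ℤ ℚ` as a `ℚ`-vector space. -/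
abbrev VF : Type := ℚ ⊗[ℤ] (Additive Fˣ)

variable {F}

/-- The class `[a]` of a nonzero field element in `V_F` (defined to be `0` for `a = 0`). -/
def cls (a : F) : VF F :=
  if h : a = 0 then 0 else (1 : ℚ) ⊗ₜ[ℤ] (Additive.ofMul (Units.mk0 a h))

variable (F) in
/-- Tensor powers of V_F over ℚ. -/
abbrev TP (n : ℕ) : Type := ⨂[ℚ]^n (VF F)

instance instTPAddCommGroup (n : ℕ) : AddCommGroup (TP F n) :=
  Module.addCommMonoidToAddCommGroup ℚ

/-- Appending one extra tensor factor on the right. -/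
def snoc {n : ℕ} : TP F n →ₗ[ℚ] VF F →ₗ[ℚ] TP F (n + 1) :=
  PiTensorProduct.lift
    ((PiTensorProduct.tprod ℚ (s := fun _ : Fin (n + 1) => VF F)).curryRight)

/-- The factor `t_i` appearing in the recursive definition of the symbol,
as a function of `(a_{i-1}, a_i, a_{i+1})`. -/
def tCoef (p a q : F) : VF F :=
  if p = a then (if a = q then 0 else cls (q - a))
  else if a = q then - cls (p - a)
  else cls ((q - a) / (p - a))

/-- The symbol `S I(a₀; a₁, …, a_m; a_{m+1})`, with the middle entries given as a list
(of length `n`). -/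
def SIaux : (n : ℕ) → (a0 : F) → (as : List F) → (b : F) → as.length = n → TP F n
  | 0, _, _, _, _ => tprod ℚ (fun i : Fin 0 => i.elim0)
  | n + 1, a0, as, b, h =>
      ∑ i : Fin (n + 1),
        snoc (SIaux n a0 (as.eraseIdx i.val) b
            (by
              have hi' := i.isLt
              have hi : i.val < as.length := by omega
              have h2 := List.length_eraseIdx_of_lt hi
              omega))
          (tCoef ((a0 :: as).getD i.val 0) (as.getD i.val 0) ((as ++ [b]).getD (i.val + 1) 0))

/-- Cyclic rotation `b₁ ⊗ … ⊗ b_N ↦ b₂ ⊗ … ⊗ b_N ⊗ b₁` on tensor powers. -/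
def rotN (n : ℕ) : TP F n ≃ₗ[ℚ] TP F n :=
  PiTensorProduct.reindex ℚ (fun _ : Fin n => VF F) (finRotate n).symm

/-- Splitting off the last tensor factor. -/
def splitLast (n : ℕ) : TP F (n + 1) ≃ₗ[ℚ] (TP F n) ⊗[ℚ] (VF F) :=
  ((PiTensorProduct.reindex ℚ (fun _ : Fin (n + 1) => VF F)
      (finSumFinEquiv (m := n) (n := 1)).symm).trans
    (PiTensorProduct.tmulEquiv ℚ (VF F)).symm).trans
    (TensorProduct.congr (LinearEquiv.refl ℚ _)
      (PiTensorProduct.subsingletonEquiv (0 : Fin 1)))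

/-- The projector `Π̃_N` annihilating symbols of products. -/
def Pit : (n : ℕ) → TP F n →ₗ[ℚ] TP F n
  | 0 => LinearMap.id
  | 1 => LinearMap.id
  | (n + 2) =>
      ((splitLast (n + 1)).symm.toLinearMap
        ∘ₗ TensorProduct.map (Pit (n + 1)) LinearMap.id
        ∘ₗ (splitLast (n + 1)).toLinearMap)
      ∘ₗ ((LinearMap.id : TP F (n + 2) →ₗ[ℚ] TP F (n + 2)) - (rotN (F := F) (n + 2)).toLinearMap)

/-- The map on `V_F` induced by a field automorphism. -/
def vmap (φ : F ≃+* F) : VF F →ₗ[ℚ] VF F :=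
  TensorProduct.AlgebraTensorModule.map (LinearMap.id : ℚ →ₗ[ℚ] ℚ)
    (AddMonoidHom.toIntLinearMap
      { toFun := fun a => Additive.ofMul ((Units.map (φ : F →* F)) a.toMul)
        map_zero' := by simp
        map_add' := by intro a b; simp [_root_.map_mul] })

/-- The induced map on tensor powers. -/
def tpMap {n : ℕ} (φ : F ≃+* F) : TP F n →ₗ[ℚ] TP F n :=
  PiTensorProduct.map (fun _ => vmap φ)


/-! ### Symbols of (multiple) polylogarithms -/

/-- Symbol of `Li₂`. -/
def SLi2 (x : F) : TP F 2 := - SIaux 2 0 [x⁻¹, 0] 1 rfl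

/-- Symbol of `Li₃`. -/
def SLi3 (x : F) : TP F 3 := - SIaux 3 0 [x⁻¹, 0, 0] 1 rfl

/-- Symbol of `Li₄`. -/
def SLi4 (x : F) : TP F 4 := - SIaux 4 0 [x⁻¹, 0, 0, 0] 1 rfl

/-- Symbol of `Li₅`. -/
def SLi5 (x : F) : TP F 5 := - SIaux 5 0 [x⁻¹, 0, 0, 0, 0] 1 rfl

/-- Symbol of `I_{3,1}(x,y) = I(0; x,0,0,y; 1)`. -/
def SI31 (x y : F) : TP F 4 := SIaux 4 0 [x, 0, 0, y] 1 rfl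

/-- Symbol of `I_{4,1}(x,y) = I(0; x,0,0,0,y; 1)`. -/
def SI41 (x y : F) : TP F 5 := SIaux 5 0 [x, 0, 0, 0, y] 1 rfl

/-- Symbol of `I⁺_{4,1}(x,y) = ½ (I_{4,1}(x,y) + I_{4,1}(x,y⁻¹))`. -/
def I41p (x y : F) : TP F 5 := (2 : ℚ)⁻¹ • (SI41 x y + SI41 x y⁻¹)

/-- The anharmonic orbit of `x`, together with the signs of the
corresponding permutations in `S₃`. -/
def anhList (x : F) : List (ℚ × F) :=
  [(1, x), (1, (1 - x)⁻¹), (1, 1 - x⁻¹), (-1, x⁻¹), (-1, 1 - x), (-1, x / (x - 1))]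

/-- Symbol of `Ĩ_{3,1}(x,y) = (1/36) Σ_{σ,π ∈ S₃} sgn(σ) sgn(π) I_{3,1}(x^σ, y^π)`. -/
def tI31 (x y : F) : TP F 4 :=
  (36 : ℚ)⁻¹ •
    ((anhList x).map (fun p =>
      ((anhList y).map (fun q => (p.1 * q.1) • SI31 p.2 q.2)).sum)).sum

/-- Symbol of `Ĩ⁺_{4,1}(x,y) = (1/6) Σ_{σ ∈ S₃} sgn(σ) I⁺_{4,1}(x^σ, y)`. -/
def tI41p (x y : F) : TP F 5 :=
  (6 : ℚ)⁻¹ • ((anhList x).map (fun p => p.1 • I41p p.2 y)).sum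

/-- Symbol of `V(z; x, y) = Ĩ_{3,1}(z, [x]+[y]+[(1-x)/(1-xy)]+[1-xy]+[(1-y)/(1-xy)])`. -/
def Vc (z x y : F) : TP F 4 :=
  tI31 z x + tI31 z y + tI31 z ((1 - x) / (1 - x * y)) + tI31 z (1 - x * y)
    + tI31 z ((1 - y) / (1 - x * y))

/-- `Sym₃₆(a,b) := I_{3,1}(a,b) - Ĩ_{3,1}(a,b)` (on the level of symbols). -/
def S36 (a b : F) : TP F 4 := SI31 a b - tI31 a b

/-! ### Generic vectors -/

variable (N m : ℕ)

/-- Polynomial ring on the entries of `N` generic vectors in `m`-space. -/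
abbrev Pol : Type := MvPolynomial (Fin N × Fin m) ℚ

/-- The field of rational functions in the entries of `N` generic vectors in `m`-space. -/
abbrev FF : Type := FractionRing (Pol N m)

/-- The `j`-th coordinate of the `i`-th generic vector. -/
def gen (i : Fin N) (j : Fin m) : FF N m :=
  algebraMap (Pol N m) (FF N m) (MvPolynomial.X (i, j))

/-- `⟨i₁ … i_m⟩`: the determinant of the matrix whose columns are
the generic vectors selected by `cols`. -/
def dets (cols : Fin m → Fin N) : FF N m :=
  (Matrix.of fun r c => gen N m (cols c) r).det

/-- The field automorphism of `FF N m` induced by a permutation of the `N` vectors. -/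
def permAut (σ : Equiv.Perm (Fin N)) : FF N m ≃+* FF N m :=
  IsFractionRing.ringEquivOfRingEquiv
    ((MvPolynomial.renameEquiv ℚ (σ.prodCongr (Equiv.refl (Fin m)))).toRingEquiv)

variable {N m}

/-- Skew-symmetrization over all permutations of the `N` generic vectors. -/
def Alt {n : ℕ} (x : TP (FF N m) n) : TP (FF N m) n :=
  ∑ σ : Equiv.Perm (Fin N), (((Equiv.Perm.sign σ : ℤˣ) : ℤ) : ℚ) • tpMap (permAut N m σ) x

end GrassPoly

end

namespace GrassPoly

noncomputable section W4

/-- The field of rational functions in the entries of 8 generic vectors in 4-space. -/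
abbrev K4 : Type := FF 8 4

/-- The vector label `k ∈ {1, …, 8}` as an index. -/
def L8 (k : ℕ) : Fin 8 := ⟨(k - 1) % 8, Nat.mod_lt _ (by norm_num)⟩

/-- `⟨abcd⟩` for vector labels in `{1, …, 8}`. -/
def d4 (a b c d : ℕ) : K4 := dets 8 4 ![L8 a, L8 b, L8 c, L8 d]

/-- Vector labels taken mod 6 in `{1, …, 6}`. -/
def M6 (j : ℕ) : ℕ := (j - 1) % 6 + 1

/-- `ρ_i = ρ_{i,i+1,i+2} = ⟨i,i+1,i+2,7⟩ / ⟨i,i+1,i+2,8⟩`, indices mod 6. -/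
def rho (i : ℕ) : K4 :=
  d4 (M6 i) (M6 (i + 1)) (M6 (i + 2)) 7 / d4 (M6 i) (M6 (i + 1)) (M6 (i + 2)) 8

/-- `ρ_{i,j} = ρ_i - ρ_j`. -/
def rr (i j : ℕ) : K4 := rho i - rho j

/-- The projected cross-ratio `CR(ab|cdef) = ⟨abce⟩⟨abdf⟩ / (⟨abcf⟩⟨abde⟩)`. -/
def CR (a b c d e f : ℕ) : K4 :=
  (d4 a b c e * d4 a b d f) / (d4 a b c f * d4 a b d e)

/-- The symbol `S(Gr₄) = 2·(4!)²·Alt₈ [⟨1234⟩ ⊗ ⟨2345⟩ ⊗ ⟨3456⟩ ⊗ ⟨4567⟩]`. -/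
def SGr4 : TP K4 4 :=
  ((2 : ℚ) * ((Nat.factorial 4 : ℚ)) ^ 2) •
    Alt (tprod ℚ ![cls (d4 1 2 3 4), cls (d4 2 3 4 5), cls (d4 3 4 5 6), cls (d4 4 5 6 7)])

/-- An elementary tensor in `V_F^{⊗4}`. -/
def tp4 (a b c d : VF K4) : TP K4 4 := tprod ℚ ![a, b, c, d]

end W4

end GrassPoly

namespace GrassPoly

noncomputable section BracketAlternation

lemma cls_mul {F : Type} [Field F] {a b : F} (ha : a ≠ 0) (hb : b ≠ 0) :
    cls (a * b) = cls a + cls b := by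
  rw [cls, cls, cls, dif_neg ha, dif_neg hb, dif_neg (mul_ne_zero ha hb), ← TensorProduct.tmul_add,
    ← ofMul_mul, Units.mk0_mul]

lemma cls_inv {F : Type} [Field F] {a : F} (ha : a ≠ 0) : cls a⁻¹ = -cls a := by
  rw [eq_neg_iff_add_eq_zero, ← cls_mul (inv_ne_zero ha) ha, inv_mul_cancel₀ ha,
    cls, dif_neg one_ne_zero, Units.mk0_one, ofMul_one, TensorProduct.tmul_zero]

lemma cls_neg {F : Type} [Field F] (a : F) : cls (-a) = cls a := by
  by_cases ha : a = 0
  · simp [ha]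
  have h : (2 : ℚ) • cls (-a) = (2 : ℚ) • cls a := by
    rw [two_smul, two_smul, ← cls_mul ha ha, ← cls_mul (neg_ne_zero.2 ha) (neg_ne_zero.2 ha),
      neg_mul_neg]
  exact smul_right_injective _ (two_ne_zero (α := ℚ)) h

lemma cls_div {F : Type} [Field F] {a b : F} (ha : a ≠ 0) (hb : b ≠ 0) :
    cls (a / b) = cls a - cls b := by
  rw [div_eq_mul_inv, cls_mul ha (inv_ne_zero hb), cls_inv hb, sub_eq_add_neg]

lemma vmap_cls {F : Type} [Field F] (φ : F ≃+* F) (a : F) : vmap φ (cls a) = cls (φ a) := by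
  by_cases ha : a = 0
  · simp [cls, ha]
  · rw [cls, cls, dif_neg ha, dif_neg (by simpa using ha)]
    simp only [vmap, TensorProduct.AlgebraTensorModule.map_tmul, LinearMap.id_apply]
    congr 1
    apply Additive.toMul.injective
    apply Units.ext
    simp

variable {N m : ℕ}

lemma permAut_gen (σ : Equiv.Perm (Fin N)) (i : Fin N) (j : Fin m) :
    permAut N m σ (gen N m i j) = gen N m (σ i) j := by
  simp [permAut, gen]

lemma permAut_dets (σ : Equiv.Perm (Fin N)) (cols : Fin m → Fin N) :
    permAut N m σ (dets N m cols) = dets N m (σ ∘ cols) := by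
  rw [dets, ← RingEquiv.coe_toRingHom, RingHom.map_det]
  congr 1
  ext r c
  simp [permAut_gen]

lemma dets_ne_zero {cols : Fin m → Fin N} (h : Function.Injective cols) : dets N m cols ≠ 0 := by
  have hd : dets N m cols = algebraMap (Pol N m) (FF N m)
      (Matrix.of fun r c => (MvPolynomial.X (cols c, r) : Pol N m)).det := by
    rw [RingHom.map_det]
    rfl
  rw [hd, Ne, IsFractionRing.to_map_eq_zero_iff]
  intro h0
  have h1 := congrArg (MvPolynomial.eval fun p : Fin N × Fin m =>
    if p.1 = cols p.2 then (1 : ℚ) else 0) h0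
  rw [RingHom.map_det, map_zero] at h1
  have hI : (MvPolynomial.eval fun p : Fin N × Fin m =>
      if p.1 = cols p.2 then (1 : ℚ) else 0).mapMatrix
      (Matrix.of fun r c => (MvPolynomial.X (cols c, r) : Pol N m)) = 1 := by
    ext r c
    simp [Matrix.one_apply, h.eq_iff, eq_comm]
  rw [hI, Matrix.det_one] at h1
  exact one_ne_zero h1

lemma dets_eq_zero {cols : Fin m → Fin N} (h : ¬ Function.Injective cols) :
    dets N m cols = 0 := by
  simp only [Function.Injective, not_forall] at h
  obtain ⟨i, j, hij, hne⟩ := h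
  exact Matrix.det_zero_of_column_eq hne fun k => by simp [hij]

lemma cls_dets_comp (cols : Fin m → Fin N) (π : Equiv.Perm (Fin m)) :
    cls (dets N m (cols ∘ π)) = cls (dets N m cols) := by
  have h : dets N m (cols ∘ π) = Equiv.Perm.sign π * dets N m cols :=
    Matrix.det_permute' π (Matrix.of fun r c => gen N m (cols c) r)
  rcases Int.units_eq_one_or (Equiv.Perm.sign π) with hs | hs <;> simp [h, hs, cls_neg]

lemma injective_of_range_eq {ι α : Type*} [Finite ι] {f g : ι → α}
    (h : Set.range f = Set.range g) (hf : Function.Injective f) : Function.Injective g := by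
  let e : Set.range g ≃ ι := (Equiv.setCongr h.symm).trans (Equiv.ofInjective f hf).symm
  have hs : Function.Surjective (e ∘ Set.rangeFactorization g) :=
    e.surjective.comp Set.rangeFactorization_surjective
  have hi := (Finite.injective_iff_surjective.2 hs).of_comp
  exact fun i j hij => hi (Subtype.ext hij)

/-- The class of a bracket depends only on its set of columns. -/
lemma cls_dets_eq_of_range_eq {cols cols' : Fin m → Fin N}
    (h : Set.range cols = Set.range cols') : cls (dets N m cols) = cls (dets N m cols') := by
  have key : Function.Injective cols ↔ Function.Injective cols' :=
    ⟨injective_of_range_eq h, injective_of_range_eq h.symm⟩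
  by_cases hc : Function.Injective cols
  · have hc' := key.1 hc
    let π : Equiv.Perm (Fin m) :=
      (Equiv.ofInjective cols hc).trans ((Equiv.setCongr h).trans (Equiv.ofInjective cols' hc').symm)
    have hπ : cols' ∘ π = cols := by
      funext i
      simp [π, Equiv.apply_ofInjective_symm]
    rw [← hπ, cls_dets_comp]
  · rw [dets_eq_zero hc, dets_eq_zero (mt key.2 hc)]

/-- The elementary tensor of the classes of the brackets with columns `M k`. -/
def bracketTensor {n : ℕ} (M : Fin n → Fin m → Fin N) : TP (FF N m) n :=
  PiTensorProduct.tprod ℚ fun k => cls (dets N m (M k))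

lemma bracketTensor_congr {n : ℕ} {M M' : Fin n → Fin m → Fin N}
    (h : ∀ k, Set.range (M k) = Set.range (M' k)) : bracketTensor M = bracketTensor M' :=
  congrArg (PiTensorProduct.tprod ℚ) (funext fun k => cls_dets_eq_of_range_eq (h k))

lemma tpMap_bracketTensor {n : ℕ} (σ : Equiv.Perm (Fin N)) (M : Fin n → Fin m → Fin N) :
    tpMap (permAut N m σ) (bracketTensor M) = bracketTensor fun k => σ ∘ M k := by
  simp [tpMap, bracketTensor, PiTensorProduct.map_tprod, vmap_cls, permAut_dets]

lemma alt_bracketTensor_comp {n : ℕ} (σ : Equiv.Perm (Fin N)) (M : Fin n → Fin m → Fin N) :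
    Alt (bracketTensor fun k => σ ∘ M k) =
      (((Equiv.Perm.sign σ : ℤˣ) : ℤ) : ℚ) • Alt (bracketTensor M) := by
  simp only [Alt, tpMap_bracketTensor, Finset.smul_sum, smul_smul]
  refine Fintype.sum_equiv (Equiv.mulRight σ) _ _ fun τ => ?_
  rcases Int.units_eq_one_or (Equiv.Perm.sign σ) with hs | hs <;>
    simp [hs, Function.comp_def]

lemma alt_sum {n : ℕ} {ι : Type} (s : Finset ι) (x : ι → TP (FF N m) n) :
    Alt (∑ i ∈ s, x i) = ∑ i ∈ s, Alt (x i) := by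
  simp only [Alt, map_sum, Finset.smul_sum]
  exact Finset.sum_comm

lemma alt_smul {n : ℕ} (c : ℚ) (x : TP (FF N m) n) : Alt (c • x) = c • Alt x := by
  simp only [Alt, map_smul, Finset.smul_sum, smul_comm c]

/-- The three-term Plücker relation. -/
lemma plucker {R : Type*} [CommRing R] (u v a b c d : Fin 4 → R) :
    (Matrix.of ![u, v, a, c]).det * (Matrix.of ![u, v, b, d]).det -
      (Matrix.of ![u, v, b, c]).det * (Matrix.of ![u, v, a, d]).det =
    (Matrix.of ![u, v, a, b]).det * (Matrix.of ![u, v, c, d]).det := by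
  simp [Matrix.det_succ_row_zero, Fin.sum_univ_succ, Fin.succAbove]
  ring

end BracketAlternation

end GrassPoly

namespace GrassPoly

noncomputable section W4

/-- The columns of `d4 a b c d`. -/
def columns (a b c d : ℕ) : Fin 4 → Fin 8 := ![L8 a, L8 b, L8 c, L8 d]

lemma d4_ne_zero {a b c d : ℕ} (h : Function.Injective (columns a b c d)) : d4 a b c d ≠ 0 :=
  dets_ne_zero h

lemma d4_eq_det (a b c d : ℕ) : d4 a b c d =
    (Matrix.of ![gen 8 4 (L8 a), gen 8 4 (L8 b), gen 8 4 (L8 c), gen 8 4 (L8 d)]).det := by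
  rw [d4, dets, ← Matrix.det_transpose]
  congr 1
  ext i j
  fin_cases i <;> rfl

lemma d4_plucker (u v a b c d : ℕ) :
    d4 u v a c * d4 u v b d - d4 u v b c * d4 u v a d = d4 u v a b * d4 u v c d := by
  simp only [d4_eq_det]
  exact plucker _ _ _ _ _ _

lemma d4_rotate (a b c d : ℕ) : d4 a b c d = d4 b c a d := by
  simp only [d4_eq_det]
  simp [Matrix.det_succ_row_zero, Fin.sum_univ_succ, Fin.succAbove]
  ring

/-- A boolean test for two quadruples of columns to have the same range. -/
def sameRange (f g : Fin 4 → Fin 8) : Bool :=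
  (List.finRange 4).all fun i => ((List.finRange 4).any fun j => Nat.beq (f i) (g j)) &&
    ((List.finRange 4).any fun j => Nat.beq (g i) (f j))

lemma range_eq_of_sameRange {f g : Fin 4 → Fin 8} (h : sameRange f g = true) :
    Set.range f = Set.range g := by
  simp only [sameRange, List.all_eq_true, List.any_eq_true, Bool.and_eq_true, List.mem_finRange,
    true_and, forall_true_left, Nat.beq_eq, Fin.val_inj] at h
  ext x
  constructor
  · rintro ⟨i, rfl⟩
    obtain ⟨j, hj⟩ := (h i).1
    exact ⟨j, hj.symm⟩
  · rintro ⟨i, rfl⟩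
    obtain ⟨j, hj⟩ := (h i).2
    exact ⟨j, hj.symm⟩

/-- The transposition of two indices, with a decidability instance that can be evaluated. -/
def transposition (p : Fin 8 × Fin 8) : Equiv.Perm (Fin 8) :=
  @Equiv.swap _ (instDecidableEqFin 8) p.1 p.2

lemma sign_transposition {p : Fin 8 × Fin 8} (h : p.1 ≠ p.2) :
    Equiv.Perm.sign (transposition p) = -1 := by
  rw [← Equiv.Perm.sign_swap h, transposition]

/-- `carries l M M'` tests that the product of the transpositions in `l` takes the column sets of
the tuple `M` to those of `M'`. -/
def carries (l : List (Fin 8 × Fin 8)) (M M' : Fin 4 → Fin 4 → Fin 8) : Bool :=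
  (l.all fun p => !(Nat.beq p.1 p.2)) &&
    (List.finRange 4).all fun k => sameRange ((l.map transposition).prod ∘ M k) (M' k)

lemma sign_prod_transposition {l : List (Fin 8 × Fin 8)} (h : ∀ p ∈ l, p.1 ≠ p.2) :
    Equiv.Perm.sign (l.map transposition).prod = (-1) ^ l.length := by
  induction l with
  | nil => simp
  | cons p l ih =>
    rw [List.map_cons, List.prod_cons, map_mul, sign_transposition (h p (by simp)),
      ih fun q hq => h q (List.mem_cons_of_mem p hq), List.length_cons, pow_succ']

lemma alt_eq_of_carries {l : List (Fin 8 × Fin 8)} {M M' : Fin 4 → Fin 4 → Fin 8}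
    (h : carries l M M' = true) :
    Alt (bracketTensor M) = (-1 : ℚ) ^ l.length • Alt (bracketTensor M') := by
  simp only [carries, Bool.and_eq_true, List.all_eq_true, List.mem_finRange,
    forall_true_left] at h
  obtain ⟨hl, hM⟩ := h
  have hl' : ∀ p ∈ l, p.1 ≠ p.2 := by
    intro p hp he
    simpa [he] using hl p hp
  rw [← bracketTensor_congr fun k => range_eq_of_sameRange (hM k), alt_bracketTensor_comp,
    sign_prod_transposition hl', smul_smul]
  simp [← mul_pow]

/-- The exponents and brackets of `ρ₄₃`, `ρ₃₂`, `ρ₂₁` and `ρ₁`, up to sign. -/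
def rhoFactor : Fin 4 → Fin 4 → ℤ × (Fin 4 → Fin 8) :=
  ![![(1, columns 3 4 5 6), (1, columns 4 5 7 8), (-1, columns 4 5 6 8), (-1, columns 3 4 5 8)],
    ![(1, columns 2 3 4 5), (1, columns 3 4 7 8), (-1, columns 3 4 5 8), (-1, columns 2 3 4 8)],
    ![(1, columns 1 2 3 4), (1, columns 2 3 7 8), (-1, columns 2 3 4 8), (-1, columns 1 2 3 8)],
    ![(1, columns 1 2 3 7), (-1, columns 1 2 3 8), (0, columns 1 2 3 7), (0, columns 1 2 3 7)]]

lemma cls_rr {i j a b c d : ℕ} (hi : rho i = d4 b c d 7 / d4 b c d 8)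
    (hj : rho j = d4 a b c 7 / d4 a b c 8)
    (h₁ : Function.Injective (columns a b c d)) (h₂ : Function.Injective (columns b c 7 8))
    (h₃ : Function.Injective (columns b c d 8)) (h₄ : Function.Injective (columns a b c 8)) :
    cls (rr i j) = cls (d4 a b c d) + cls (d4 b c 7 8) - cls (d4 b c d 8) - cls (d4 a b c 8) := by
  have n₁ := d4_ne_zero h₁
  have n₂ := d4_ne_zero h₂
  have n₃ := d4_ne_zero h₃
  have n₄ := d4_ne_zero h₄
  have h : rr i j = -((d4 a b c d * d4 b c 7 8) / (d4 b c d 8 * d4 a b c 8)) := by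
    rw [rr, hi, hj, div_sub_div _ _ n₃ n₄, ← neg_div]
    congr 1
    rw [d4_rotate a b c 7, d4_rotate a b c 8, d4_rotate a b c d, ← d4_plucker b c a d 7 8]
    ring
  rw [h, cls_neg, cls_div (mul_ne_zero n₁ n₂) (mul_ne_zero n₃ n₄), cls_mul n₁ n₂, cls_mul n₃ n₄]
  abel

lemma columns_injective {a b c d : ℕ}
    (h : ((L8 a : ℕ) ≠ L8 b ∧ (L8 a : ℕ) ≠ L8 c ∧ (L8 a : ℕ) ≠ L8 d) ∧
      ((L8 b : ℕ) ≠ L8 c ∧ (L8 b : ℕ) ≠ L8 d) ∧ (L8 c : ℕ) ≠ L8 d) :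
    Function.Injective (columns a b c d) := by
  simp only [ne_eq, Fin.val_inj] at h
  intro i j
  fin_cases i <;> fin_cases j <;> simp [columns] <;> grind

/-- Transpositions whose products sort the nonvanishing terms of the expansion. -/
def sortingSwaps : List (List (Fin 8 × Fin 8)) :=
   [[(0, 5), (1, 4), (2, 3)],
    [(0, 5), (1, 4), (2, 3), (6, 7)],
    [(0, 6), (1, 4), (2, 3), (5, 6), (6, 7)],
    [(0, 6), (1, 5), (2, 3), (4, 5), (5, 6), (6, 7)],
    [(0, 6), (1, 5), (2, 4), (3, 5), (4, 6), (5, 7), (6, 7)],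
    [(0, 6), (1, 5), (2, 4), (3, 5), (4, 6), (5, 7)],
    [(0, 6), (1, 5), (2, 4), (3, 4), (4, 6), (5, 7), (6, 7)],
    [(0, 6), (1, 5), (2, 4), (3, 4), (4, 5), (5, 7)],
    [(0, 6), (1, 5), (2, 4), (3, 4), (4, 5), (5, 6), (6, 7)],
    [(0, 5), (1, 4), (2, 3), (5, 7)],
    [(0, 6), (1, 5), (2, 3), (3, 5), (4, 6), (5, 7)],
    [(0, 5), (1, 4), (2, 3), (4, 5), (5, 7)],
    [(0, 6), (1, 4), (2, 3), (3, 4), (4, 6), (5, 7), (6, 7)],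
    [(0, 5), (1, 4), (2, 3), (3, 4), (4, 5), (5, 7)]]

/-- The columns of `⟨1234⟩`, `⟨2345⟩`, `⟨3456⟩`, `⟨4567⟩`. -/
def standardColumns : Fin 4 → Fin 4 → Fin 8 :=
  ![columns 1 2 3 4, columns 2 3 4 5, columns 3 4 5 6, columns 4 5 6 7]

/-- The coefficient of a term of the expansion. -/
def termCoeff (r : Fin 4 → Fin 4) : ℤ :=
  (rhoFactor 0 (r 0)).1 * (rhoFactor 1 (r 1)).1 * (rhoFactor 2 (r 2)).1 * (rhoFactor 3 (r 3)).1

/-- The columns of a term of the expansion. -/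
def termColumns (r : Fin 4 → Fin 4) : Fin 4 → Fin 4 → Fin 8 := fun k => (rhoFactor k (r k)).2

/-- A test for a term to vanish, because a transposition fixes it or its coefficient is zero. -/
def termVanishes (r : Fin 4 → Fin 4) : Bool :=
  Int.beq' (termCoeff r) 0 || (List.finRange 8).any fun a => (List.finRange 8).any fun b =>
    carries [(a, b)] (termColumns r) (termColumns r)

/-- A test for a term to vanish or to be the negative of the standard one. -/
def termChecks (r : Fin 4 → Fin 4) : Bool :=
  termVanishes r || sortingSwaps.any fun l =>
    Int.beq' (termCoeff r * (-1) ^ l.length) (-1) && carries l (termColumns r) standardColumns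

/-- The multiple of the standard term to which a term is equal. -/
def termValue (r : Fin 4 → Fin 4) : ℤ := bif termVanishes r then 0 else -1

lemma termChecks_eq_true (a b c d : Fin 4) : termChecks ![a, b, c, d] = true := by
  have h : ((List.finRange 4).all fun a => (List.finRange 4).all fun b =>
      (List.finRange 4).all fun c => (List.finRange 4).all fun d =>
        termChecks ![a, b, c, d]) = true := rfl
  simp only [List.all_eq_true, List.mem_finRange, forall_true_left] at h
  exact h a b c d

lemma sum_termValue : ∑ a, ∑ b, ∑ c, ∑ d, termValue ![a, b, c, d] = -14 := rfl

lemma alt_term (r : Fin 4 → Fin 4) (h : termChecks r = true) :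
    (termCoeff r : ℚ) • Alt (bracketTensor (termColumns r)) =
      (termValue r : ℚ) • Alt (bracketTensor standardColumns) := by
  by_cases hv : termVanishes r = true
  · rw [termValue, hv, cond_true, Int.cast_zero, zero_smul]
    simp only [termVanishes, Bool.or_eq_true, Int.beq'_eq, List.any_eq_true, List.mem_finRange,
      true_and] at hv
    rcases hv with hc | ⟨a, b, hab⟩
    · rw [hc, Int.cast_zero, zero_smul]
    · have h0 := alt_eq_of_carries hab
      rw [List.length_singleton, pow_one, neg_smul, one_smul] at h0
      have h2 : (2 : ℚ) • Alt (bracketTensor (termColumns r)) = 0 := by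
        rw [two_smul]
        nth_rewrite 1 [h0]
        exact neg_add_cancel _
      rw [(smul_eq_zero.1 h2).resolve_left two_ne_zero, smul_zero]
  · rw [termChecks, Bool.or_eq_true, or_iff_right hv] at h
    simp only [List.any_eq_true, Bool.and_eq_true, Int.beq'_eq] at h
    obtain ⟨l, -, hc, hl⟩ := h
    rw [alt_eq_of_carries hl, smul_smul, termValue, Bool.eq_false_of_not_eq_true hv, cond_false,
      ← hc]
    push_cast
    rfl

/-- Quadruples of elements as functions on `Fin 4`. -/
def quadrupleEquiv : Fin 4 × Fin 4 × Fin 4 × Fin 4 ≃ (Fin 4 → Fin 4) where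
  toFun p := ![p.1, p.2.1, p.2.2.1, p.2.2.2]
  invFun r := (r 0, r 1, r 2, r 3)
  left_inv _ := rfl
  right_inv r := by
    funext i
    fin_cases i <;> rfl

lemma alt_sum_rhoFactor :
    Alt (PiTensorProduct.tprod ℚ fun k => ∑ j, ((rhoFactor k j).1 : ℚ) •
      cls (dets 8 4 (rhoFactor k j).2)) = (-14 : ℚ) • Alt (bracketTensor standardColumns) := by
  rw [MultilinearMap.map_sum, alt_sum, ← Equiv.sum_comp quadrupleEquiv]
  have hterm : ∀ p : Fin 4 × Fin 4 × Fin 4 × Fin 4,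
      Alt (PiTensorProduct.tprod ℚ fun k => ((rhoFactor k (quadrupleEquiv p k)).1 : ℚ) •
        cls (dets 8 4 (rhoFactor k (quadrupleEquiv p k)).2)) =
      (termValue ![p.1, p.2.1, p.2.2.1, p.2.2.2] : ℚ) • Alt (bracketTensor standardColumns) := by
    intro p
    rw [MultilinearMap.map_smul_univ, alt_smul,
      ← alt_term _ (termChecks_eq_true p.1 p.2.1 p.2.2.1 p.2.2.2)]
    congr 1
    rw [Fin.prod_univ_four, termCoeff]
    push_cast
    rfl
  rw [Finset.sum_congr rfl fun p _ => hterm p, ← Finset.sum_smul]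
  congr 1
  simp only [Fintype.sum_prod_type]
  exact_mod_cast sum_termValue

lemma cls_rr_four_three : cls (rr 4 3) =
    ∑ j, ((rhoFactor 0 j).1 : ℚ) • cls (dets 8 4 (rhoFactor 0 j).2) := by
  rw [cls_rr (i := 4) (j := 3) (a := 3) (b := 4) (c := 5) (d := 6) rfl rfl]
  · simp [rhoFactor, Fin.sum_univ_four, d4, columns, sub_eq_add_neg]
  all_goals exact columns_injective (by simp [L8])

lemma cls_rr_three_two : cls (rr 3 2) =
    ∑ j, ((rhoFactor 1 j).1 : ℚ) • cls (dets 8 4 (rhoFactor 1 j).2) := by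
  rw [cls_rr (i := 3) (j := 2) (a := 2) (b := 3) (c := 4) (d := 5) rfl rfl]
  · simp [rhoFactor, Fin.sum_univ_four, d4, columns, sub_eq_add_neg]
  all_goals exact columns_injective (by simp [L8])

lemma cls_rr_two_one : cls (rr 2 1) =
    ∑ j, ((rhoFactor 2 j).1 : ℚ) • cls (dets 8 4 (rhoFactor 2 j).2) := by
  rw [cls_rr (i := 2) (j := 1) (a := 1) (b := 2) (c := 3) (d := 4) rfl rfl]
  · simp [rhoFactor, Fin.sum_univ_four, d4, columns, sub_eq_add_neg]
  all_goals exact columns_injective (by simp [L8])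

lemma cls_rho_one : cls (rho 1) =
    ∑ j, ((rhoFactor 3 j).1 : ℚ) • cls (dets 8 4 (rhoFactor 3 j).2) := by
  have h : rho 1 = d4 1 2 3 7 / d4 1 2 3 8 := rfl
  rw [h, cls_div]
  · simp [rhoFactor, Fin.sum_univ_four, d4, columns, sub_eq_add_neg]
  all_goals exact d4_ne_zero (columns_injective (by simp [L8]))

end W4

end GrassPoly

open GrassPoly

/-- equation `rho4321`:
`Alt₈[[ρ₄₃]⊗[ρ₃₂]⊗[ρ₂₁]⊗[ρ₁]] = -14·Alt₈[[⟨1234⟩]⊗[⟨2345⟩]⊗[⟨3456⟩]⊗[⟨4567⟩]]`. -/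
theorem rho4321_identity :
    Alt (tp4 (cls (rr 4 3)) (cls (rr 3 2)) (cls (rr 2 1)) (cls (rho 1))) =
      (-14 : ℚ) • Alt (tp4 (cls (d4 1 2 3 4)) (cls (d4 2 3 4 5))
        (cls (d4 3 4 5 6)) (cls (d4 4 5 6 7))) := by
  have hl : tp4 (cls (rr 4 3)) (cls (rr 3 2)) (cls (rr 2 1)) (cls (rho 1)) =
      PiTensorProduct.tprod ℚ fun k => ∑ j, ((rhoFactor k j).1 : ℚ) •
        cls (dets 8 4 (rhoFactor k j).2) := by
    rw [tp4]
    congr 1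
    funext k
    fin_cases k
    exacts [cls_rr_four_three, cls_rr_three_two, cls_rr_two_one, cls_rho_one]
  have hr : tp4 (cls (d4 1 2 3 4)) (cls (d4 2 3 4 5)) (cls (d4 3 4 5 6)) (cls (d4 4 5 6 7)) =
      bracketTensor standardColumns := by
    rw [tp4, bracketTensor]
    congr 1
    funext k
    fin_cases k <;> rfl
  rw [hl, hr, alt_sum_rhoFactor]
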